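/- (Characterization of flat formulas) Let φ be a consistent formula of propositional team logic (i.e., X ⊨ φ for some nonempty team X) whose variables are among p₁,…,pₙ. The following are equivalent: (i) φ is flat; (ii) φ ≡ Θ_X for some nonempty team X on {p₁,…,pₙ}; (iii) φ ≡ ¬¬φ; (iv) ⊨ φ⊗¬φ. -/

import Mathlib

inductive PTForm : Type
  | var : ℕ → PTForm
  | bot : PTForm
  | top : PTForm
  | neg : PTForm → PTForm
  | conj : PTForm → PTForm → PTForm
  | tensor : PTForm → PTForm → PTForm
  | disj : PTForm → PTForm → PTForm
  | impl : PTForm → PTForm → PTForm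
  | dep : List PTForm → PTForm → PTForm

abbrev Val := ℕ → Bool
abbrev Team := Set Val

def PTSat : Team → PTForm → Prop
  | X, .var n => ∀ v ∈ X, v n = true
  | X, .bot => X = ∅
  | _, .top => True
  | X, .neg φ => ∀ v ∈ X, ¬ PTSat {v} φ
  | X, .conj φ ψ => PTSat X φ ∧ PTSat X ψ
  | X, .tensor φ ψ => ∃ Y Z, X = Y ∪ Z ∧ PTSat Y φ ∧ PTSat Z ψ
  | X, .disj φ ψ => PTSat X φ ∨ PTSat X ψ
  | X, .impl φ ψ => ∀ Y ⊆ X, PTSat Y φ → PTSat Y ψ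
  | X, .dep l ψ => ∀ Y ⊆ X,
      (∀ φ ∈ l, PTSat Y φ ∨ (∀ v ∈ Y, ¬ PTSat {v} φ)) →
      (PTSat Y ψ ∨ (∀ v ∈ Y, ¬ PTSat {v} ψ))

def PTValid (φ : PTForm) : Prop := ∀ X : Team, PTSat X φ
def PTConseq (φ ψ : PTForm) : Prop := ∀ X : Team, PTSat X φ → PTSat X ψ
def PTEquiv (φ ψ : PTForm) : Prop := ∀ X : Team, PTSat X φ ↔ PTSat X ψ
def PTSetConseq (Γ : Set PTForm) (φ : PTForm) : Prop :=
  ∀ X : Team, (∀ ψ ∈ Γ, PTSat X ψ) → PTSat X φ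
def Flat (φ : PTForm) : Prop :=
  ∀ X : Team, PTSat X φ ↔ ∀ v ∈ X, PTSat {v} φ

/-- All propositional variables of a formula are among `p_0, …, p_{n-1}`. -/
def VarsBelow (n : ℕ) : PTForm → Prop
  | .var m => m < n
  | .bot => True
  | .top => True
  | .neg φ => VarsBelow n φ
  | .conj φ ψ => VarsBelow n φ ∧ VarsBelow n ψ
  | .tensor φ ψ => VarsBelow n φ ∧ VarsBelow n ψ
  | .disj φ ψ => VarsBelow n φ ∧ VarsBelow n ψ
  | .impl φ ψ => VarsBelow n φ ∧ VarsBelow n ψ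
  | .dep l ψ => (∀ φ ∈ l, VarsBelow n φ) ∧ VarsBelow n ψ

/-- The restriction of a valuation to the variables `p_0, …, p_{n-1}`. -/
def restrict (n : ℕ) (v : Val) : Fin n → Bool := fun i => v i.val

/-- The team of all valuations whose restriction to `p_0, …, p_{n-1}` lies in
a given team on those variables. -/
def liftTeam (n : ℕ) (Y : Set (Fin n → Bool)) : Team :=
  {w : Val | restrict n w ∈ Y}

/-- Finite intuitionistic disjunction (`⊥` for the empty list). -/
def bigDisj (l : List PTForm) : PTForm := l.foldr .disj .bot

/-- Finite tensor disjunction (`⊥` for the empty list). -/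
def bigTensor (l : List PTForm) : PTForm := l.foldr .tensor .bot

/-- The conjunction `p_0^{v(p_0)} ∧ … ∧ p_{n-1}^{v(p_{n-1})}`,
where `p¹ = p` and `p⁰ = ¬p`. -/
def literal (n : ℕ) (v : Fin n → Bool) : PTForm :=
  (List.finRange n).foldr
    (fun i acc => .conj (if v i then .var i.val else .neg (.var i.val)) acc) .top

open Classical in
/-- `Θ_X := ¬¬⋁_{v∈X} (p_0^{v(p_0)} ∧ … ∧ p_{n-1}^{v(p_{n-1})})` for a nonempty
team `X` on `p_0, …, p_{n-1}`, and `Θ_∅ := ⊥`. -/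
noncomputable def Theta (n : ℕ) (X : Set (Fin n → Bool)) : PTForm :=
  if X = ∅ then .bot
  else .neg (.neg (bigDisj (X.toFinite.toFinset.toList.map (literal n))))

/-- `Θ⊗_X := ⨂_{v∈X} (p_0^{v(p_0)} ∧ … ∧ p_{n-1}^{v(p_{n-1})})`
(the tensor normal form; `⊥` for `X = ∅`). -/
noncomputable def ThetaTensor (n : ℕ) (X : Set (Fin n → Bool)) : PTForm :=
  bigTensor (X.toFinite.toFinset.toList.map (literal n))

abbrev Subst := ℕ → PTForm

def applySubst (σ : Subst) : PTForm → PTForm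
  | .var n => σ n
  | .bot => .bot
  | .top => .top
  | .neg φ => .neg (applySubst σ φ)
  | .conj φ ψ => .conj (applySubst σ φ) (applySubst σ ψ)
  | .tensor φ ψ => .tensor (applySubst σ φ) (applySubst σ ψ)
  | .disj φ ψ => .disj (applySubst σ φ) (applySubst σ ψ)
  | .impl φ ψ => .impl (applySubst σ φ) (applySubst σ ψ)
  | .dep l ψ => .dep (l.attach.map (fun x => applySubst σ x.1)) (applySubst σ ψ)
decreasing_by
  all_goals simp_wf
  all_goals first
    | (have := List.sizeOf_lt_of_mem x.2; omega)
    | omega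

def FlatSubst (σ : Subst) : Prop := ∀ n : ℕ, Flat (σ n)

open Classical in
noncomputable def valSub (σ : Subst) (v : Val) : Val :=
  fun p => if PTSat {v} (σ p) then true else false

noncomputable def teamSub (σ : Subst) (X : Team) : Team := valSub σ '' X

/-- A formula is F-projective if some flat substitution unifies it and is,
modulo the formula, the identity on variables. -/
def FProjective (φ : PTForm) : Prop :=
  ∃ σ : Subst, FlatSubst σ ∧ PTValid (applySubst σ φ) ∧
    ∀ p : ℕ,
      (∀ X : Team, PTSat X φ → PTSat X (σ p) → PTSat X (.var p)) ∧
      (∀ X : Team, PTSat X φ → PTSat X (.var p) → PTSat X (σ p))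

/-- Prucnal's substitution determined by a formula `θ` and a valuation `v` on
`p_0, …, p_{n-1}`: `σ(p) = θ ∧ p` if `v(p) = 0` and `σ(p) = θ → p` if
`v(p) = 1` (identity outside the domain of `v`). -/
def prucnal (θ : PTForm) (n : ℕ) (v : Fin n → Bool) : Subst :=
  fun p => if h : p < n then
      (if v ⟨p, h⟩ then .impl θ (.var p) else .conj θ (.var p))
    else .var p

/-- The variant of Prucnal's substitution used for the tensor normal form:
`σ(p) = θ ∧ p` if `v(p) = 0` and `σ(p) = ¬θ ⊗ p` if `v(p) = 1`. -/
def prucnalT (θ : PTForm) (n : ℕ) (v : Fin n → Bool) : Subst :=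
  fun p => if h : p < n then
      (if v ⟨p, h⟩ then .tensor (.neg θ) (.var p) else .conj θ (.var p))
    else .var p

/-- A formula contains no dependence atoms and no intuitionistic disjunction. -/
def IsClassical : PTForm → Prop
  | .var _ => True
  | .bot => True
  | .top => True
  | .neg φ => IsClassical φ
  | .conj φ ψ => IsClassical φ ∧ IsClassical ψ
  | .tensor φ ψ => IsClassical φ ∧ IsClassical ψ
  | .disj _ _ => False
  | .impl φ ψ => IsClassical φ ∧ IsClassical ψ
  | .dep _ _ => False

/-- Classical truth-table satisfaction by a single valuation, reading `⊗` as
classical disjunction. -/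
def CSat (v : Val) : PTForm → Prop
  | .var n => v n = true
  | .bot => False
  | .top => True
  | .neg φ => ¬ CSat v φ
  | .conj φ ψ => CSat v φ ∧ CSat v ψ
  | .tensor φ ψ => CSat v φ ∨ CSat v ψ
  | .disj φ ψ => CSat v φ ∨ CSat v ψ
  | .impl φ ψ => CSat v φ → CSat v ψ
  | .dep _ _ => True

/-- Formulas of propositional dependence logic (PD): atoms `p`, `¬p`, `⊥`, `⊤`,
dependence atoms with variable arguments, conjunction and tensor. -/
inductive PDForm : Type
  | pos : ℕ → PDForm
  | negv : ℕ → PDForm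
  | bot : PDForm
  | top : PDForm
  | dep : List ℕ → ℕ → PDForm
  | conj : PDForm → PDForm → PDForm
  | tensor : PDForm → PDForm → PDForm

/-- The embedding of PD formulas into PT formulas. -/
def PDForm.toPT : PDForm → PTForm
  | .pos n => .var n
  | .negv n => .neg (.var n)
  | .bot => .bot
  | .top => .top
  | .dep l q => .dep (l.map .var) (.var q)
  | .conj φ ψ => .conj φ.toPT ψ.toPT
  | .tensor φ ψ => .tensor φ.toPT ψ.toPT

/-- The syntactic (De Morgan) negation `φ~` of a PD formula. -/
def PDForm.synNeg : PDForm → PDForm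
  | .pos n => .negv n
  | .negv n => .pos n
  | .bot => .top
  | .top => .bot
  | .dep _ _ => .bot
  | .conj φ ψ => .tensor φ.synNeg ψ.synNeg
  | .tensor φ ψ => .conj φ.synNeg ψ.synNeg

theorem ptSat_empty : ∀ φ : PTForm, PTSat ∅ φ
  | .var _ => by simp [PTSat]
  | .bot => by simp [PTSat]
  | .top => by simp [PTSat]
  | .neg _ => by simp [PTSat]
  | .conj φ ψ => by
      rw [PTSat]
      exact ⟨ptSat_empty φ, ptSat_empty ψ⟩
  | .tensor φ ψ => by
      rw [PTSat]
      exact ⟨∅, ∅, by simp, ptSat_empty φ, ptSat_empty ψ⟩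
  | .disj φ ψ => by
      rw [PTSat]
      exact Or.inl (ptSat_empty φ)
  | .impl φ ψ => by
      rw [PTSat]
      intro Y hY _
      rw [Set.subset_empty_iff.mp hY]
      exact ptSat_empty ψ
  | .dep l ψ => by
      rw [PTSat]
      intro Y hY _
      rw [Set.subset_empty_iff.mp hY]
      exact Or.inl (ptSat_empty ψ)

theorem PTSat.mono : ∀ {φ : PTForm} {X Y : Team}, PTSat X φ → Y ⊆ X → PTSat Y φ
  | .var _, X, Y, h, hYX => by
      rw [PTSat] at h ⊢
      exact fun v hv => h v (hYX hv)
  | .bot, X, Y, h, hYX => by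
      rw [PTSat] at h ⊢
      exact Set.subset_empty_iff.mp (h ▸ hYX)
  | .top, X, Y, h, hYX => by simp [PTSat]
  | .neg _, X, Y, h, hYX => by
      rw [PTSat] at h ⊢
      exact fun v hv => h v (hYX hv)
  | .conj φ ψ, X, Y, h, hYX => by
      rw [PTSat] at h ⊢
      exact ⟨h.1.mono hYX, h.2.mono hYX⟩
  | .tensor φ ψ, X, Y, h, hYX => by
      rw [PTSat] at h ⊢
      obtain ⟨A, B, rfl, hA, hB⟩ := h
      refine ⟨Y ∩ A, Y ∩ B, ?_, hA.mono Set.inter_subset_right, hB.mono Set.inter_subset_right⟩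
      rw [← Set.inter_union_distrib_left, Set.inter_eq_left.mpr hYX]
  | .disj φ ψ, X, Y, h, hYX => by
      rw [PTSat] at h ⊢
      exact h.imp (fun h => h.mono hYX) (fun h => h.mono hYX)
  | .impl φ ψ, X, Y, h, hYX => by
      rw [PTSat] at h ⊢
      exact fun Z hZ => h Z (hZ.trans hYX)
  | .dep l ψ, X, Y, h, hYX => by
      rw [PTSat] at h ⊢
      exact fun Z hZ => h Z (hZ.trans hYX)

theorem ptSat_singleton_iff_cSat (v : Val) : ∀ φ : PTForm, PTSat {v} φ ↔ CSat v φ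
  | .var _ => by simp [PTSat, CSat]
  | .bot => by simp [PTSat, CSat]
  | .top => by simp [PTSat, CSat]
  | .neg φ => by simp [PTSat, CSat, ptSat_singleton_iff_cSat v φ]
  | .conj φ ψ => by
      simp [PTSat, CSat, ptSat_singleton_iff_cSat v φ, ptSat_singleton_iff_cSat v ψ]
  | .tensor φ ψ => by
      rw [PTSat, CSat, ← ptSat_singleton_iff_cSat v φ, ← ptSat_singleton_iff_cSat v ψ]
      constructor
      · rintro ⟨Y, Z, h, hY, hZ⟩
        have hv : v ∈ Y ∪ Z := h ▸ Set.mem_singleton v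
        exact hv.imp (fun hv => hY.mono (Set.singleton_subset_iff.mpr hv))
          (fun hv => hZ.mono (Set.singleton_subset_iff.mpr hv))
      · rintro (h | h)
        · exact ⟨{v}, ∅, by simp, h, ptSat_empty ψ⟩
        · exact ⟨∅, {v}, by simp, ptSat_empty φ, h⟩
  | .disj φ ψ => by
      simp [PTSat, CSat, ptSat_singleton_iff_cSat v φ, ptSat_singleton_iff_cSat v ψ]
  | .impl φ ψ => by
      rw [PTSat, CSat, ← ptSat_singleton_iff_cSat v φ, ← ptSat_singleton_iff_cSat v ψ]
      refine ⟨fun h => h {v} subset_rfl, fun h Y hY hφ => ?_⟩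
      rcases Set.subset_singleton_iff_eq.mp hY with rfl | rfl
      · exact ptSat_empty ψ
      · exact h hφ
  | .dep l ψ => by
      simp only [PTSat, CSat, iff_true]
      intro Y hY _
      rcases Set.subset_singleton_iff_eq.mp hY with rfl | rfl
      · exact Or.inl (ptSat_empty ψ)
      · simpa using em _

theorem cSat_congr {n : ℕ} {v w : Val} (h : restrict n v = restrict n w) :
    ∀ {φ : PTForm}, VarsBelow n φ → (CSat v φ ↔ CSat w φ)
  | .var m, hφ => by
      rw [VarsBelow] at hφ
      have : v m = w m := congrFun h ⟨m, hφ⟩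
      rw [CSat, CSat, this]
  | .bot, _ => by simp [CSat]
  | .top, _ => by simp [CSat]
  | .neg φ, hφ => by
      rw [VarsBelow] at hφ
      rw [CSat, CSat, cSat_congr h hφ]
  | .conj φ ψ, hφ => by
      rw [VarsBelow] at hφ
      rw [CSat, CSat, cSat_congr h hφ.1, cSat_congr h hφ.2]
  | .tensor φ ψ, hφ => by
      rw [VarsBelow] at hφ
      rw [CSat, CSat, cSat_congr h hφ.1, cSat_congr h hφ.2]
  | .disj φ ψ, hφ => by
      rw [VarsBelow] at hφ
      rw [CSat, CSat, cSat_congr h hφ.1, cSat_congr h hφ.2]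
  | .impl φ ψ, hφ => by
      rw [VarsBelow] at hφ
      rw [CSat, CSat, cSat_congr h hφ.1, cSat_congr h hφ.2]
  | .dep l ψ, _ => by simp [CSat]

theorem flat_iff {φ : PTForm} : Flat φ ↔ ∀ X : Team, PTSat X φ ↔ ∀ v ∈ X, CSat v φ := by
  simp only [Flat, ptSat_singleton_iff_cSat]

theorem ptSat_neg_iff {X : Team} {φ : PTForm} : PTSat X (.neg φ) ↔ ∀ v ∈ X, ¬ CSat v φ := by
  simp only [PTSat, ptSat_singleton_iff_cSat]

theorem ptSat_neg_neg_iff {X : Team} {φ : PTForm} :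
    PTSat X (.neg (.neg φ)) ↔ ∀ v ∈ X, CSat v φ := by
  simp only [ptSat_neg_iff, CSat, not_not]

theorem cSat_bigDisj_iff {v : Val} {l : List PTForm} :
    CSat v (bigDisj l) ↔ ∃ φ ∈ l, CSat v φ := by
  induction l with
  | nil => simp [bigDisj, CSat]
  | cons φ l ih =>
    rw [bigDisj] at ih
    simp [bigDisj, CSat, ih]

theorem cSat_literal_iff {n : ℕ} {v : Val} {u : Fin n → Bool} :
    CSat v (literal n u) ↔ restrict n v = u := by
  have key : ∀ l : List (Fin n),
      CSat v (l.foldr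
        (fun i acc => .conj (if u i then .var i.val else .neg (.var i.val)) acc) .top) ↔
      ∀ i ∈ l, v i = u i := by
    intro l
    induction l with
    | nil => simp [CSat]
    | cons i l ih =>
      rw [List.foldr_cons, CSat, ih, List.forall_mem_cons]
      cases u i <;> simp [CSat]
  rw [literal, key, funext_iff]
  simp [restrict]

theorem ptSat_theta_iff {n : ℕ} {X : Set (Fin n → Bool)} {T : Team} :
    PTSat T (Theta n X) ↔ ∀ v ∈ T, restrict n v ∈ X := by
  rcases X.eq_empty_or_nonempty with rfl | hX
  · simp [Theta, PTSat, Set.eq_empty_iff_forall_notMem]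
  · rw [Theta, if_neg hX.ne_empty, ptSat_neg_neg_iff]
    simp [cSat_bigDisj_iff, cSat_literal_iff]

/-- Characterization of flat formulas. -/
theorem pt_flat_characterization (n : ℕ) (φ : PTForm) (hvars : VarsBelow n φ)
    (hcons : ∃ X : Team, X.Nonempty ∧ PTSat X φ) :
    [Flat φ,
     ∃ X : Set (Fin n → Bool), X.Nonempty ∧ PTEquiv φ (Theta n X),
     PTEquiv φ (.neg (.neg φ)),
     PTValid (.tensor φ (.neg φ))].TFAE := by
  tfae_have 1 → 3 := fun h X => by
    rw [flat_iff.mp h X, ptSat_neg_neg_iff]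
  tfae_have 3 → 2 := fun h => by
    obtain ⟨X, ⟨v, hv⟩, hX⟩ := hcons
    have hvφ := (ptSat_singleton_iff_cSat v φ).mp (hX.mono (Set.singleton_subset_iff.mpr hv))
    refine ⟨restrict n '' {w | CSat w φ}, ⟨_, v, hvφ, rfl⟩, fun T => ?_⟩
    rw [h T, ptSat_neg_neg_iff, ptSat_theta_iff]
    refine forall₂_congr fun w _ => ⟨fun hw => ⟨w, hw, rfl⟩, ?_⟩
    rintro ⟨u, hu, huw⟩
    exact (cSat_congr huw hvars).mp hu
  tfae_have 2 → 1 := by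
    rintro ⟨X, -, h⟩ T
    simp only [h _, ptSat_theta_iff, Set.mem_singleton_iff, forall_eq]
  tfae_have 1 → 4 := fun h X => by
    rw [PTSat]
    refine ⟨{v ∈ X | CSat v φ}, {v ∈ X | ¬ CSat v φ}, ?_, (flat_iff.mp h _).mpr fun v hv => hv.2,
      ptSat_neg_iff.mpr fun v hv => hv.2⟩
    ext v
    simp only [Set.mem_union, Set.mem_ofPred_eq]
    tauto
  tfae_have 4 → 1 := fun h X => by
    refine ⟨fun hX v hv => hX.mono (Set.singleton_subset_iff.mpr hv), fun hX => ?_⟩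
    have hX' := h X
    rw [PTSat] at hX'
    obtain ⟨Y, Z, rfl, hY, hZ⟩ := hX'
    rw [PTSat] at hZ
    refine hY.mono (Set.union_subset subset_rfl fun v hv => ?_)
    exact absurd (hX v (Or.inr hv)) (hZ v hv)
  tfae_finish
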